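/- Let d ≥ 1 and p ≥ 1, let μ be the Lebesgue measure restricted to the cube [0,1]^d (a Borel probability measure on ℝ^d), let y₁, y₂ ∈ ℝ^d, and for t ∈ [0,1] let ν_t = t·δ_{y₁} + (1−t)·δ_{y₂}. With transportation cost c(x,y) = ‖x−y‖^p (Euclidean norm), one has inf_{t ∈ [0,1]} W_c(μ, ν_t) = ∫_{[0,1]^d} min{‖x−y₁‖^p, ‖x−y₂‖^p} dx. -/

import Mathlib

open MeasureTheory Set
open scoped ENNReal

noncomputable section

/-- A coupling whose second marginal is concentrated on `{y₁, y₂}` costs at least the integral of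
the pointwise cheaper of the two costs. -/
theorem lintegral_min_le_lintegral_of_ae_snd {E F : Type*} [MeasurableSpace E] [MeasurableSpace F]
    {c : E → F → ℝ≥0∞} {y₁ y₂ : F} (h₁ : Measurable fun x ↦ c x y₁)
    (h₂ : Measurable fun x ↦ c x y₂) {π : Measure (E × F)}
    (hπ : ∀ᵐ y ∂π.map Prod.snd, y = y₁ ∨ y = y₂) :
    ∫⁻ x, min (c x y₁) (c x y₂) ∂π.map Prod.fst ≤ ∫⁻ q, c q.1 q.2 ∂π := by
  rw [lintegral_map (h₁.min h₂) measurable_fst]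
  refine lintegral_mono_ae ?_
  filter_upwards [ae_of_ae_map measurable_snd.aemeasurable hπ] with q hq
  rcases hq with hq | hq
  · exact hq ▸ min_le_left _ _
  · exact hq ▸ min_le_right _ _

/-- A two-valued map pushes a measure forward to a combination of two Dirac masses. -/
theorem map_piecewise_const {E F : Type*} [MeasurableSpace E] [MeasurableSpace F]
    (μ : Measure E) {A : Set E} [DecidablePred (· ∈ A)] (hA : MeasurableSet A) (y₁ y₂ : F) :
    μ.map (A.piecewise (fun _ ↦ y₁) (fun _ ↦ y₂)) =
      μ A • Measure.dirac y₁ + μ Aᶜ • Measure.dirac y₂ := by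
  have hT : Measurable (A.piecewise (fun _ ↦ y₁) (fun _ ↦ y₂)) :=
    Measurable.piecewise hA measurable_const measurable_const
  ext s hs
  rw [Measure.map_apply hT hs, Set.piecewise_preimage, Set.ite,
    measure_union (disjoint_sdiff_right.mono_left inter_subset_right)
      ((measurable_const hs).diff hA)]
  by_cases a : y₁ ∈ s <;> by_cases b : y₂ ∈ s <;>
    simp [a, b, hs, compl_eq_univ_sdiff]

/-- The unit cube of a Euclidean space has volume one. -/
theorem EuclideanSpace.volume_unitCube (ι : Type*) [Fintype ι] :
    volume {x : EuclideanSpace ℝ ι | ∀ i, x i ∈ Icc (0 : ℝ) 1} = 1 := by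
  have h : {x : EuclideanSpace ℝ ι | ∀ i, x i ∈ Icc (0 : ℝ) 1} =
      WithLp.ofLp ⁻¹' (Set.pi univ fun _ : ι ↦ Icc (0 : ℝ) 1) := by
    ext x
    simp only [mem_ofPred_eq, mem_preimage, mem_univ_pi]
  rw [h, (PiLp.volume_preserving_ofLp ι).measure_preimage
    (MeasurableSet.univ_pi fun _ ↦ measurableSet_Icc).nullMeasurableSet, volume_pi_pi]
  simp

/-- Transporting a probability measure onto two points, with free choice of the two weights, costs
the integral of the pointwise cheaper of the two costs. -/
theorem iInf_iInf_lintegral_coupling_eq {E : Type*} [MeasurableSpace E]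
    [MeasurableSingletonClass E] {c : E → E → ℝ≥0∞} (hc : Measurable (Function.uncurry c))
    (μ : Measure E) [IsProbabilityMeasure μ] (y₁ y₂ : E) :
    (⨅ t ∈ Icc (0 : ℝ) 1,
      ⨅ π ∈ {π : Measure (E × E) | IsProbabilityMeasure π ∧ π.map Prod.fst = μ ∧ π.map Prod.snd =
          ENNReal.ofReal t • Measure.dirac y₁ + ENNReal.ofReal (1 - t) • Measure.dirac y₂},
        ∫⁻ q, c q.1 q.2 ∂π) =
      ∫⁻ x, min (c x y₁) (c x y₂) ∂μ := by
  have hcy (y) : Measurable fun x ↦ c x y := hc.comp (measurable_id.prodMk measurable_const)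
  apply le_antisymm
  · classical
    let A : Set E := {x | c x y₁ ≤ c x y₂}
    have hA : MeasurableSet A := measurableSet_le (hcy y₁) (hcy y₂)
    let T := A.piecewise (fun _ ↦ y₁) (fun _ ↦ y₂)
    have hT : Measurable T := Measurable.piecewise hA measurable_const measurable_const
    have hG : Measurable fun x ↦ (x, T x) := measurable_id.prodMk hT
    refine (iInf₂_le (μ.real A) ⟨measureReal_nonneg, measureReal_le_one⟩).trans ?_
    refine (iInf₂_le (μ.map fun x ↦ (x, T x))
      ⟨Measure.isProbabilityMeasure_map hG.aemeasurable, ?_, ?_⟩).trans ?_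
    · refine (lintegral_map hc hG).trans_le (lintegral_mono fun x ↦ ?_)
      change c x (T x) ≤ _
      by_cases hx : x ∈ A
      · rw [show T x = y₁ from A.piecewise_eq_of_mem _ _ hx]
        exact le_min le_rfl hx
      · rw [show T x = y₂ from A.piecewise_eq_of_notMem _ _ hx]
        exact le_min (not_le.mp hx).le le_rfl
    · rw [Measure.map_map measurable_fst hG]
      exact Measure.map_id
    · rw [Measure.map_map measurable_snd hG, ← probReal_compl_eq_one_sub hA,
        ofReal_measureReal, ofReal_measureReal]
      exact map_piecewise_const μ hA y₁ y₂
  · refine le_iInf₂ fun t _ ↦ le_iInf₂ fun π hπ ↦ ?_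
    obtain ⟨-, hπ₁, hπ₂⟩ := hπ
    rw [← hπ₁]
    refine lintegral_min_le_lintegral_of_ae_snd (hcy y₁) (hcy y₂) ?_
    rw [hπ₂, ae_add_measure_iff]
    exact ⟨Measure.ae_smul_measure (by simp [ae_dirac_eq]) _,
      Measure.ae_smul_measure (by simp [ae_dirac_eq]) _⟩

/-- The infimum over `t ∈ [0,1]` of the optimal transport distance between the Lebesgue
measure on the unit cube and `ν_t = t δ_{y₁} + (1−t) δ_{y₂}` (with cost
`c(x,y) = ‖x−y‖^p`) equals `∫_{[0,1]^d} min{‖x−y₁‖^p, ‖x−y₂‖^p} dx`. -/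
theorem stmt_1
    (d : ℕ) (hd : 1 ≤ d) (p : ℝ) (hp : 1 ≤ p)
    (cube : Set (EuclideanSpace ℝ (Fin d)))
    (hcube : cube = {x : EuclideanSpace ℝ (Fin d) | ∀ i, x i ∈ Icc (0 : ℝ) 1})
    (μ : Measure (EuclideanSpace ℝ (Fin d))) (hμ : μ = volume.restrict cube)
    (y₁ y₂ : EuclideanSpace ℝ (Fin d))
    (ν : ℝ → Measure (EuclideanSpace ℝ (Fin d)))
    (hν : ∀ t, ν t = ENNReal.ofReal t • Measure.dirac y₁ +
      ENNReal.ofReal (1 - t) • Measure.dirac y₂)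
    (W : Measure (EuclideanSpace ℝ (Fin d)) → Measure (EuclideanSpace ℝ (Fin d)) → ℝ≥0∞)
    (hW : ∀ μ' ν', W μ' ν' =
      ⨅ π ∈ {π : Measure (EuclideanSpace ℝ (Fin d) × EuclideanSpace ℝ (Fin d)) |
          IsProbabilityMeasure π ∧ π.map Prod.fst = μ' ∧ π.map Prod.snd = ν'},
        ∫⁻ q, ENNReal.ofReal (‖q.1 - q.2‖ ^ p) ∂π) :
    (⨅ t ∈ Icc (0 : ℝ) 1, W μ (ν t)) =
      ∫⁻ x in cube, ENNReal.ofReal (min (‖x - y₁‖ ^ p) (‖x - y₂‖ ^ p)) := by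
  have : IsProbabilityMeasure μ :=
    ⟨by rw [hμ, Measure.restrict_apply_univ, hcube, EuclideanSpace.volume_unitCube]⟩
  have hc : Measurable (Function.uncurry fun x y : EuclideanSpace ℝ (Fin d) ↦
      ENNReal.ofReal (‖x - y‖ ^ p)) :=
    ((measurable_fst.sub measurable_snd).norm.pow_const p).ennreal_ofReal
  simp only [hW, hν, ENNReal.ofReal_min]
  rw [← hμ]
  exact iInf_iInf_lintegral_coupling_eq hc μ y₁ y₂
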